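/- There is no topological embedding of the real projective plane ℝP² into ℝ³: every continuous injective map from ℝP² to ℝ³ fails to be a homeomorphism onto its image, and in fact no continuous injection ℝP² → ℝ³ exists. (Since ℝP² is compact, it suffices to state: there is no continuous injective map from ℝP² to ℝ³.) -/

import Mathlib

open scoped LinearAlgebra.Projectivization

/-- The projectivization `ℙ K V` (the space of lines through the origin of `V`), topologized as
the quotient of `V \ {0}` (with the subspace topology) by the scaling relation. -/
instance Projectivization.instTopologicalSpace {K V : Type*} [DivisionRing K] [AddCommGroup V]
    [Module K V] [TopologicalSpace V] : TopologicalSpace (Projectivization K V) :=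
  instTopologicalSpaceQuotient

namespace RP2
open scoped Quaternion RealInnerProductSpace
open Set

/-- The set of maps with a property stable under uniformly small perturbation is everything,
if the domain is compact and contractible. -/
lemma good_of_contract {X M : Type*} [TopologicalSpace X] [CompactSpace X] [MetricSpace M]
    (H : C(unitInterval × X, X)) (H0 : ∀ x, H (0, x) = x) (x0 : X) (H1 : ∀ x, H (1, x) = x0)
    (Good : C(X, M) → Prop) (ε : ℝ) (hε : 0 < ε)
    (stab : ∀ f g : C(X, M), Good f → (∀ x, dist (f x) (g x) < ε) → Good g)
    (hconst : ∀ m : M, Good (ContinuousMap.const X m)) (f : C(X, M)) : Good f := by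
  let γ : C(unitInterval, C(X, M)) := (f.comp H).curry
  have hstab : ∀ f g : C(X, M), Good f → dist f g < ε → Good g := fun f g hf hd =>
    stab f g hf (fun x => lt_of_le_of_lt (ContinuousMap.dist_apply_le_dist x) hd)
  have hopen : IsOpen {f : C(X, M) | Good f} := by
    rw [Metric.isOpen_iff]
    intro f hf
    refine ⟨ε, hε, fun g hg => hstab f g hf ?_⟩
    rw [dist_comm]; exact hg
  have hclosed : IsClosed {f : C(X, M) | Good f} := by
    rw [← isOpen_compl_iff, Metric.isOpen_iff]
    intro f hf
    refine ⟨ε, hε, fun g hg hg' => hf (hstab g f hg' hg)⟩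
  have hcl : IsClopen (γ ⁻¹' {f : C(X, M) | Good f}) :=
    ⟨hclosed.preimage γ.continuous, hopen.preimage γ.continuous⟩
  have h1 : (1 : unitInterval) ∈ γ ⁻¹' {f : C(X, M) | Good f} := by
    have : γ 1 = ContinuousMap.const X (f x0) := by
      ext x; simp [γ, H1]
    change Good (γ 1)
    rw [this]; exact hconst _
  have huniv := hcl.eq_univ ⟨1, h1⟩
  have h0 : (0 : unitInterval) ∈ γ ⁻¹' {f : C(X, M) | Good f} := by rw [huniv]; trivial
  have : γ 0 = f := by ext x; simp [γ, H0]
  have h0' : Good (γ 0) := h0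
  rwa [this] at h0'

/-- Logarithms of circle valued maps exist on `s`. -/
def T1 {E : Type*} [TopologicalSpace E] (s : Set E) : Prop :=
  ∀ l : E → ℂ, ContinuousOn l s → (∀ x ∈ s, ‖l x‖ = 1) →
    ∃ θ : E → ℝ, ContinuousOn θ s ∧ ∀ x ∈ s, Complex.exp (θ x * Complex.I) = l x

/-- The quaternion unit `i`. -/
def qi : ℍ[ℝ] := ⟨0, 1, 0, 0⟩
/-- The quaternion unit `j`. -/
def qj : ℍ[ℝ] := ⟨0, 0, 1, 0⟩
/-- The quaternion unit `k`. -/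
def qk : ℍ[ℝ] := ⟨0, 0, 0, 1⟩

@[simp] lemma qi_re : qi.re = 0 := rfl
@[simp] lemma qi_imI : qi.imI = 1 := rfl
@[simp] lemma qi_imJ : qi.imJ = 0 := rfl
@[simp] lemma qi_imK : qi.imK = 0 := rfl
@[simp] lemma qj_re : qj.re = 0 := rfl
@[simp] lemma qj_imI : qj.imI = 0 := rfl
@[simp] lemma qj_imJ : qj.imJ = 1 := rfl
@[simp] lemma qj_imK : qj.imK = 0 := rfl
@[simp] lemma qk_re : qk.re = 0 := rfl
@[simp] lemma qk_imI : qk.imI = 0 := rfl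
@[simp] lemma qk_imJ : qk.imJ = 0 := rfl
@[simp] lemma qk_imK : qk.imK = 1 := rfl

/-- Maps from `s` to the sphere of unit imaginary quaternions lift through the Hopf map. -/
def T2 {E : Type*} [TopologicalSpace E] (s : Set E) : Prop :=
  ∀ n : E → ℍ[ℝ], ContinuousOn n s → (∀ x ∈ s, n x * n x = -1) →
    ∃ ψ : E → ℍ[ℝ], ContinuousOn ψ s ∧ ∀ x ∈ s, ‖ψ x‖ = 1 ∧ n x * ψ x = ψ x * qi

/-- `s` is compact and contracts to a point. -/
structure Contr {E : Type*} [TopologicalSpace E] (s : Set E) : Prop where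
  cpt : IsCompact s
  ex : ∃ (H : C(unitInterval × s, s)) (x0 : s), (∀ x, H (0, x) = x) ∧ ∀ x, H (1, x) = x0

lemma ext_of_subtype {E F : Type*} [TopologicalSpace E] [TopologicalSpace F] [Inhabited F]
    {s : Set E} (f : C(s, F)) : ∃ g : E → F, ContinuousOn g s ∧ ∀ x : s, g x = f x := by
  classical
  refine ⟨fun x => if h : x ∈ s then f ⟨x, h⟩ else default, ?_, fun x => by simp⟩
  rw [continuousOn_iff_continuous_domRestrict]
  convert f.continuous using 1
  ext x; simp

lemma Contr.preconn {E : Type*} [TopologicalSpace E] {s : Set E} (h : Contr s) :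
    IsPreconnected s := by
  obtain ⟨H, x0, H0, H1⟩ := h.ex
  refine isPreconnected_of_forall (x0 : E) fun y hy => ?_
  refine ⟨range (fun t : unitInterval => (H (t, ⟨y, hy⟩) : E)), ?_, ⟨1, by simp [H1]⟩,
    ⟨0, by simp [H0]⟩, ?_⟩
  · rintro _ ⟨t, rfl⟩; exact Subtype.property _
  · apply isPreconnected_range; fun_prop

lemma Contr.t1 {E : Type*} [TopologicalSpace E] {s : Set E} (h : Contr s) : T1 s := by
  intro l hl hl1
  obtain ⟨H, x0, H0, H1⟩ := h.ex
  have : CompactSpace s := isCompact_iff_compactSpace.1 h.cpt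
  let f : C(s, Metric.sphere (0 : ℂ) 1) :=
    ⟨fun x => ⟨l x, by simpa using hl1 x x.2⟩, by
      apply Continuous.subtype_mk
      exact continuousOn_iff_continuous_domRestrict.1 hl⟩
  have key := good_of_contract H H0 x0 H1
    (fun f : C(s, Metric.sphere (0 : ℂ) 1) => ∃ θ : C(s, ℝ), ∀ x,
      Complex.exp (θ x * Complex.I) = f x) 1 one_pos ?_ ?_ f
  · obtain ⟨θ, hθ⟩ := key
    obtain ⟨g, hg, hg'⟩ := ext_of_subtype θ
    refine ⟨g, hg, fun x hx => ?_⟩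
    have := hg' ⟨x, hx⟩
    simp only at this
    rw [this, hθ]; rfl
  · rintro f g ⟨θ, hθ⟩ hd
    have hf0 : ∀ x, ‖(f x : ℂ)‖ = 1 := fun x => by simpa using (f x).2
    have hg0 : ∀ x, ‖(g x : ℂ)‖ = 1 := fun x => by simpa using (g x).2
    have hf1 : ∀ x, (f x : ℂ) ≠ 0 := fun x => by
      rw [← norm_ne_zero_iff, hf0]; norm_num
    have hsl : ∀ x, (g x : ℂ) / f x ∈ Complex.slitPlane := by
      intro x
      have h1 : ‖((g x : ℂ) - f x) / f x‖ < 1 := by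
        rw [norm_div, hf0, div_one]
        have := hd x
        rw [dist_comm, Subtype.dist_eq, dist_eq_norm] at this
        exact this
      have := Complex.mem_slitPlane_of_norm_lt_one h1
      convert this using 1
      field_simp [hf1 x]; ring
    refine ⟨⟨fun x => θ x + ((g x : ℂ) / f x).arg, ?_⟩, ?_⟩
    · refine θ.continuous.add ?_
      rw [continuous_iff_continuousAt]
      intro x
      refine ContinuousAt.comp (g := Complex.arg) (f := fun x => (g x : ℂ) / f x) (Complex.continuousAt_arg (hsl x)) ?_
      refine ContinuousAt.div ?_ ?_ (hf1 x) <;> fun_prop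
    · intro x
      have h2 := Complex.norm_mul_exp_arg_mul_I ((g x : ℂ) / f x)
      rw [norm_div, hf0, hg0] at h2
      have hfx := hf1 x
      simp only [ContinuousMap.coe_mk, Complex.ofReal_add, add_mul, Complex.exp_add, hθ]
      norm_num at h2
      rw [h2]; field_simp
  · intro m
    refine ⟨ContinuousMap.const _ (m : ℂ).arg, fun x => ?_⟩
    have h2 := Complex.norm_mul_exp_arg_mul_I (m : ℂ)
    have : ‖(m : ℂ)‖ = 1 := by simpa using m.2
    rw [this] at h2
    simpa using h2

lemma norm_of_sq {n : ℍ[ℝ]} (h : n * n = -1) : ‖n‖ = 1 := by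
  have : ‖n‖ * ‖n‖ = 1 := by rw [← norm_mul, h]; simp
  nlinarith [norm_nonneg n]

lemma qi_sq : qi * qi = -1 := by
  ext <;> simp

lemma qi_norm : ‖qi‖ = 1 := norm_of_sq qi_sq

lemma imag_of_sq {n : ℍ[ℝ]} (h : n * n = -1) : n.re = 0 := by
  have h1 := norm_of_sq h
  have h2 : n.re ^ 2 + n.imI ^ 2 + n.imJ ^ 2 + n.imK ^ 2 = 1 := by
    rw [← Quaternion.normSq_def', Quaternion.normSq_eq_norm_mul_self, h1]; norm_num
  have h3 := congrArg QuaternionAlgebra.re h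
  simp at h3
  nlinarith

lemma proj_rel {n : ℍ[ℝ]} (h : n * n = -1) (φ : ℍ[ℝ]) :
    n * (φ - n * φ * qi) = (φ - n * φ * qi) * qi := by
  have e1 : n * (n * φ * qi) = -(φ * qi) := by
    rw [← mul_assoc, ← mul_assoc, h]; simp
  have e2 : n * φ * qi * qi = - (n * φ) := by
    rw [mul_assoc, qi_sq]; simp
  rw [mul_sub, sub_mul, e1, e2]; abel

lemma Contr.t2 {E : Type*} [TopologicalSpace E] {s : Set E} (h : Contr s) : T2 s := by
  intro l hl hl1
  obtain ⟨H, x0, H0, H1⟩ := h.ex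
  have : CompactSpace s := isCompact_iff_compactSpace.1 h.cpt
  let f : C(s, {n : ℍ[ℝ] // n * n = -1}) :=
    ⟨fun x => ⟨l x, hl1 x x.2⟩, by
      apply Continuous.subtype_mk
      exact continuousOn_iff_continuous_domRestrict.1 hl⟩
  have key := good_of_contract H H0 x0 H1
    (fun f : C(s, {n : ℍ[ℝ] // n * n = -1}) => ∃ ψ : C(s, ℍ[ℝ]), ∀ x,
      ψ x ≠ 0 ∧ (f x : ℍ[ℝ]) * ψ x = ψ x * qi) 1 one_pos ?_ ?_ f
  · obtain ⟨θ, hθ⟩ := key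
    obtain ⟨g, hg, hg'⟩ := ext_of_subtype θ
    refine ⟨fun x => (‖g x‖⁻¹ : ℝ) • g x, ?_, fun x hx => ?_⟩
    · refine ContinuousOn.smul (ContinuousOn.inv₀ hg.norm ?_) hg
      intro x hx
      have := hg' ⟨x, hx⟩
      simp only at this
      rw [this, norm_ne_zero_iff]; exact (hθ _).1
    · have := hg' ⟨x, hx⟩
      simp only at this ⊢
      rw [this]
      obtain ⟨h1, h2⟩ := hθ ⟨x, hx⟩
      constructor
      · rw [norm_smul, norm_inv, norm_norm, inv_mul_cancel₀ (norm_ne_zero_iff.2 h1)]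
      · rw [mul_smul_comm, smul_mul_assoc, ← h2]; rfl
  · rintro f g ⟨ψ, hψ⟩ hd
    refine ⟨⟨fun x => ψ x - (g x : ℍ[ℝ]) * ψ x * qi, by fun_prop⟩, fun x => ⟨?_, ?_⟩⟩
    · obtain ⟨h1, h2⟩ := hψ x
      have e : ψ x - (g x : ℍ[ℝ]) * ψ x * qi = (2 : ℝ) • ψ x - ((g x : ℍ[ℝ]) - f x) * ψ x * qi := by
        have : (f x : ℍ[ℝ]) * ψ x * qi = - ψ x := by rw [h2, mul_assoc, qi_sq]; simp
        rw [sub_mul, sub_mul, this, two_smul]; abel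
      simp only [ContinuousMap.coe_mk]
      rw [e]
      intro h0
      have h3 := congrArg norm (sub_eq_zero.1 h0)
      rw [norm_smul, norm_mul, norm_mul, qi_norm] at h3
      have h4 := hd x
      rw [dist_comm, Subtype.dist_eq, dist_eq_norm] at h4
      have h5 := norm_pos_iff.2 h1
      rw [Real.norm_of_nonneg (by norm_num : (0 : ℝ) ≤ 2)] at h3
      nlinarith
    · exact proj_rel (g x).2 _
  · intro m
    by_cases hm : (1 : ℍ[ℝ]) - m * 1 * qi = 0
    · refine ⟨ContinuousMap.const _ qj, fun x => ⟨?_, ?_⟩⟩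
      · intro h
        have := congrArg QuaternionAlgebra.imJ h
        simp at this
      · have : (m : ℍ[ℝ]) = -qi := by
          have h1 : (1 : ℍ[ℝ]) = m * qi := by simpa using sub_eq_zero.1 hm
          calc (m : ℍ[ℝ]) = - (m * (qi * qi)) := by rw [qi_sq]; simp
            _ = - (m * qi * qi) := by rw [mul_assoc]
            _ = _ := by rw [← h1]; simp
        simp only [ContinuousMap.const_apply, this]
        ext <;> simp
    · exact ⟨ContinuousMap.const _ (1 - m * 1 * qi), fun x => ⟨hm, proj_rel m.2 1⟩⟩

/-- Continuous functions with values in `2πℤ` are constant on preconnected sets. -/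
lemma int_const {E : Type*} [TopologicalSpace E] {s : Set E} (hs : IsPreconnected s) (c : E → ℝ)
    (hc : ContinuousOn c s) (h : ∀ x ∈ s, Complex.exp (c x * Complex.I) = 1) :
    ∃ m : ℤ, ∀ x ∈ s, c x = 2 * Real.pi * m := by
  have hint : ∀ x ∈ s, ∃ m : ℤ, c x / (2 * Real.pi) = m := by
    intro x hx
    obtain ⟨m, hm⟩ := Complex.exp_eq_one_iff.1 (h x hx)
    refine ⟨m, ?_⟩
    have h2 : (c x : ℂ) = ((m * (2 * Real.pi) : ℝ) : ℂ) := by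
      have : (c x : ℂ) * Complex.I = (m * (2 * Real.pi)) * Complex.I := by rw [hm]; ring
      have := mul_right_cancel₀ Complex.I_ne_zero this
      rw [this]; push_cast; ring
    have h3 := Complex.ofReal_injective h2
    rw [h3]; field_simp
  rcases s.eq_empty_or_nonempty with rfl | ⟨x0, hx0⟩
  · exact ⟨0, by simp⟩
  obtain ⟨m, hm⟩ := hint x0 hx0
  have hd : IsDiscrete (range (fun n : ℤ => (n : ℝ))) := by
    have := Int.isClosedEmbedding_coe_real.isEmbedding
    exact isDiscrete_iff_discreteTopology.2 (this.toHomeomorph.symm.isEmbedding.discreteTopology)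
  refine ⟨m, fun x hx => ?_⟩
  have := hs.constant_of_mapsTo hd (f := fun x => c x / (2 * Real.pi)) (hc.div_const _)
    (fun y hy => by obtain ⟨k, hk⟩ := hint y hy; exact ⟨k, hk.symm⟩) hx hx0
  simp only [hm] at this
  rw [← this]; field_simp

lemma glue_cont {E F : Type*} [TopologicalSpace E] [TopologicalSpace F] {A B : Set E}
    (hA : IsClosed A) (hB : IsClosed B) (f g : E → F) (hf : ContinuousOn f A)
    (hg : ContinuousOn g B) (hfg : ∀ x ∈ A ∩ B, f x = g x) :
    ∃ h : E → F, ContinuousOn h (A ∪ B) ∧ (∀ x ∈ A, h x = f x) ∧ ∀ x ∈ B, h x = g x := by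
  classical
  have h1 : ∀ x ∈ A, (if x ∈ A then f x else g x) = f x := fun x hx => by simp [hx]
  have h2 : ∀ x ∈ B, (if x ∈ A then f x else g x) = g x := fun x hx => by
    by_cases h : x ∈ A
    · simp [h, hfg x ⟨h, hx⟩]
    · simp [h]
  exact ⟨fun x => if x ∈ A then f x else g x,
    ContinuousOn.union_of_isClosed (hf.congr h1) (hg.congr h2) hA hB, h1, h2⟩

lemma glue_t1 {E : Type*} [TopologicalSpace E] {A B : Set E} (hA : IsClosed A) (hB : IsClosed B)
    (h1 : T1 A) (h2 : T1 B) (h3 : IsPreconnected (A ∩ B)) : T1 (A ∪ B) := by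
  intro l hl hl1
  obtain ⟨α, hα, hα'⟩ := h1 l (hl.mono subset_union_left) (fun x hx => hl1 x (Or.inl hx))
  obtain ⟨β, hβ, hβ'⟩ := h2 l (hl.mono subset_union_right) (fun x hx => hl1 x (Or.inr hx))
  obtain ⟨m, hm⟩ := int_const h3 (fun x => α x - β x)
    ((hα.mono inter_subset_left).sub (hβ.mono inter_subset_right)) (by
      intro x hx
      push_cast
      rw [sub_mul, Complex.exp_sub, hα' x hx.1, hβ' x hx.2, div_self]
      rw [← norm_ne_zero_iff, hl1 x (Or.inl hx.1)]; norm_num)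
  obtain ⟨θ, hθ, ha, hb⟩ := glue_cont hA hB α (fun x => β x + 2 * Real.pi * m) hα
    (hβ.add continuousOn_const) (fun x hx => by linarith [hm x hx])
  refine ⟨θ, hθ, ?_⟩
  rintro x (hx | hx)
  · rw [ha x hx, hα' x hx]
  · rw [hb x hx, ← hβ' x hx]
    push_cast
    rw [add_mul, Complex.exp_add]
    have : Complex.exp (2 * Real.pi * m * Complex.I) = 1 := by
      rw [Complex.exp_eq_one_iff]; exact ⟨m, by ring⟩
    rw [this, mul_one]

/-- Two lifts of the same point differ by a unit complex number. -/
lemma fiber {n p q : ℍ[ℝ]} (hp : ‖p‖ = 1) (hq : ‖q‖ = 1) (h1 : n * p = p * qi)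
    (h2 : n * q = q * qi) : ∃ c : ℂ, ‖c‖ = 1 ∧ q = p * (c : ℍ[ℝ]) ∧
      c = ⟨(star p * q).re, (star p * q).imI⟩ := by
  have hpp : star p * p = 1 := by
    rw [Quaternion.star_mul_self, Quaternion.normSq_eq_norm_mul_self, hp]; simp
  have hpp' : p * star p = 1 := by
    rw [Quaternion.self_mul_star, Quaternion.normSq_eq_norm_mul_self, hp]; simp
  set d := star p * q with hd
  have hqd : q = p * d := by rw [hd, ← mul_assoc, hpp', one_mul]
  have hcomm : qi * d = d * qi := by
    have e1 : star p * n = qi * star p := by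
      calc star p * n = star p * n * (p * star p) := by rw [hpp', mul_one]
        _ = star p * (n * p) * star p := by simp only [mul_assoc]
        _ = star p * p * qi * star p := by rw [h1]; simp only [mul_assoc]
        _ = _ := by rw [hpp, one_mul]
    rw [hd, ← mul_assoc, ← e1, mul_assoc, h2, mul_assoc]
  have hJ : d.imJ = 0 := by
    have := congrArg QuaternionAlgebra.imK hcomm
    simp at this; linarith
  have hK : d.imK = 0 := by
    have := congrArg QuaternionAlgebra.imJ hcomm
    simp at this; linarith
  have hdc : d = ((⟨d.re, d.imI⟩ : ℂ) : ℍ[ℝ]) := by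
    ext <;> simp [hJ, hK]
  have hn : ‖d‖ = 1 := by rw [hd, norm_mul, norm_star, hp, hq, one_mul]
  refine ⟨⟨d.re, d.imI⟩, ?_, by rw [← hdc, ← hqd], rfl⟩
  have h5 : d.re ^ 2 + d.imI ^ 2 + d.imJ ^ 2 + d.imK ^ 2 = 1 := by
    rw [← Quaternion.normSq_def', Quaternion.normSq_eq_norm_mul_self, hn]; norm_num
  rw [hJ, hK] at h5
  have : Complex.normSq ⟨d.re, d.imI⟩ = 1 := by rw [Complex.normSq_mk]; linarith
  rw [Complex.norm_def, this, Real.sqrt_one]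

lemma continuous_coeC : Continuous (fun c : ℂ => (c : ℍ[ℝ])) :=
  Quaternion.ofComplex.toLinearMap.continuous_of_finiteDimensional

lemma norm_coeC (c : ℂ) : ‖(c : ℍ[ℝ])‖ = ‖c‖ := by
  have h : ‖(c : ℍ[ℝ])‖ * ‖(c : ℍ[ℝ])‖ = ‖c‖ * ‖c‖ := by
    rw [← Quaternion.normSq_eq_norm_mul_self, Quaternion.normSq_def', Complex.norm_mul_self_eq_normSq,
      Complex.normSq_apply]
    simp; ring
  exact (mul_self_inj (norm_nonneg _) (norm_nonneg _)).1 h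

lemma qi_comm (c : ℂ) : qi * (c : ℍ[ℝ]) = c * qi := by
  ext <;> simp

lemma fiber_cont {E : Type*} [TopologicalSpace E] {s : Set E} {p q : E → ℍ[ℝ]}
    (hp : ContinuousOn p s) (hq : ContinuousOn q s) :
    ContinuousOn (fun x => (⟨(star (p x) * q x).re, (star (p x) * q x).imI⟩ : ℂ)) s := by
  have h : ContinuousOn (fun x => star (p x) * q x) s := hp.star.mul hq
  have h1 := Quaternion.continuous_re.comp_continuousOn h
  have h2 := Quaternion.continuous_imI.comp_continuousOn h
  have : ContinuousOn (fun x => (((star (p x) * q x).re : ℂ) +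
      ((star (p x) * q x).imI : ℂ) * Complex.I)) s :=
    (Complex.continuous_ofReal.comp_continuousOn h1).add
      ((Complex.continuous_ofReal.comp_continuousOn h2).mul continuousOn_const)
  refine this.congr fun x hx => ?_
  apply Complex.ext <;> simp

lemma glue_t2 {E : Type*} [TopologicalSpace E] [NormalSpace E] {A B : Set E} (hA : IsClosed A)
    (hB : IsClosed B) (h1 : T2 A) (h2 : T2 B) (h3 : T1 (A ∩ B)) : T2 (A ∪ B) := by
  intro n hn hn1
  obtain ⟨α, hα, hα'⟩ := h1 n (hn.mono subset_union_left) (fun x hx => hn1 x (Or.inl hx))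
  obtain ⟨β, hβ, hβ'⟩ := h2 n (hn.mono subset_union_right) (fun x hx => hn1 x (Or.inr hx))
  obtain ⟨τ, hτ, hτ'⟩ := h3 _ (fiber_cont (hβ.mono inter_subset_right) (hα.mono inter_subset_left))
    (by
      intro x hx
      obtain ⟨c, hc, -, rfl⟩ := fiber (hβ' x hx.2).1 (hα' x hx.1).1 (hβ' x hx.2).2 (hα' x hx.1).2
      exact hc)
  obtain ⟨g, hg⟩ := ContinuousMap.exists_restrict_eq (hA.inter hB)
    (⟨(A ∩ B).domRestrict τ, continuousOn_iff_continuous_domRestrict.1 hτ⟩ : C(↥(A ∩ B), ℝ))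
  have hg' : ∀ x ∈ A ∩ B, g x = τ x := fun x hx => congrArg (fun f : C(↥(A ∩ B), ℝ) => f ⟨x, hx⟩) hg
  obtain ⟨ψ, hψ, ha, hb⟩ := glue_cont hA hB α
    (fun x => β x * ((Complex.exp (g x * Complex.I) : ℂ) : ℍ[ℝ])) hα
    (hβ.mul (continuous_coeC.comp (by fun_prop)).continuousOn) (by
      intro x hx
      obtain ⟨c, hc, h4, h5⟩ := fiber (hβ' x hx.2).1 (hα' x hx.1).1 (hβ' x hx.2).2 (hα' x hx.1).2
      rw [hg' x hx, hτ' x hx, ← h5]; exact h4)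
  refine ⟨ψ, hψ, ?_⟩
  rintro x (hx | hx)
  · rw [ha x hx]; exact hα' x hx
  · rw [hb x hx]
    constructor
    · rw [norm_mul, (hβ' x hx).1, norm_coeC, Complex.norm_exp_ofReal_mul_I, one_mul]
    · rw [← mul_assoc, (hβ' x hx).2, mul_assoc, qi_comm, mul_assoc]

section sphere
variable {E : Type*} [NormedAddCommGroup E] [InnerProductSpace ℝ E] [FiniteDimensional ℝ E]

/-- Unit sphere of a subspace. -/
def Sph (W : Submodule ℝ E) : Set E := {x | ‖x‖ = 1 ∧ x ∈ W}
/-- Closed hemisphere. -/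
def Hem (W : Submodule ℝ E) (e : E) : Set E := {x | (‖x‖ = 1 ∧ x ∈ W) ∧ 0 ≤ ⟪x, e⟫}

lemma hem_closed (W : Submodule ℝ E) (e : E) : IsClosed (Hem W e) := by
  have hW : IsClosed (W : Set E) := W.closed_of_finiteDimensional
  have h : IsClosed {x : E | 0 ≤ ⟪x, e⟫} :=
    isClosed_le continuous_const (continuous_id.inner continuous_const)
  exact ((isClosed_eq continuous_norm continuous_const).inter hW).inter h

lemma hem_contr (W : Submodule ℝ E) {e : E} (he : ‖e‖ = 1) (heW : e ∈ W) : Contr (Hem W e) := by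
  constructor
  · refine (isCompact_sphere (0 : E) 1).of_isClosed_subset (hem_closed W e) ?_
    intro x hx
    simpa using hx.1.1
  · have hee : ⟪e, e⟫ = 1 := by rw [real_inner_self_eq_norm_sq, he]; norm_num
    have hne : ∀ (t : unitInterval) (x : E), x ∈ Hem W e →
        ((1 - t : ℝ) • x + (t : ℝ) • e) ≠ 0 := by
      intro t x hx h0
      have h1 := congrArg (fun y => ⟪y, e⟫) h0
      simp only [inner_add_left, real_inner_smul_left, hee, inner_zero_left] at h1
      have h2 := t.2.1
      have h3 : 0 ≤ 1 - (t : ℝ) := by linarith [t.2.2]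
      have h4 := mul_nonneg h3 hx.2
      have h5 : (t : ℝ) = 0 := by linarith
      rw [h5] at h0
      have h6 := hx.1.1
      simp at h0
      rw [h0] at h6; simp at h6
    let F : unitInterval × Hem W e → E := fun p =>
      ‖(1 - p.1 : ℝ) • (p.2 : E) + (p.1 : ℝ) • e‖⁻¹ • ((1 - p.1 : ℝ) • (p.2 : E) + (p.1 : ℝ) • e)
    have hF : Continuous F := by
      have hc : Continuous fun p : unitInterval × Hem W e =>
        (1 - p.1 : ℝ) • (p.2 : E) + (p.1 : ℝ) • e := by fun_prop
      exact (hc.norm.inv₀ (fun p => norm_ne_zero_iff.2 (hne p.1 p.2 p.2.2))).smul hc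
    have hm : ∀ p, F p ∈ Hem W e := by
      intro p
      have h0 := hne p.1 p.2 p.2.2
      refine ⟨⟨?_, ?_⟩, ?_⟩
      · simp only [F]
        rw [norm_smul, norm_inv, norm_norm, inv_mul_cancel₀ (norm_ne_zero_iff.2 h0)]
      · exact W.smul_mem _ (W.add_mem (W.smul_mem _ p.2.2.1.2) (W.smul_mem _ heW))
      · simp only [F, inner_add_left, real_inner_smul_left, hee]
        have h3 : 0 ≤ 1 - (p.1 : ℝ) := by linarith [p.1.2.2]
        have h4 := mul_nonneg h3 p.2.2.2
        have h5 := p.1.2.1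
        positivity
    refine ⟨⟨fun p => ⟨F p, hm p⟩, hF.subtype_mk _⟩, ⟨e, ⟨he, heW⟩, by rw [hee]; norm_num⟩, ?_, ?_⟩
    · intro x
      have : ‖(x : E)‖ = 1 := x.2.1.1
      apply Subtype.ext
      simp [F, this]
    · intro x
      apply Subtype.ext
      simp [F, he]

lemma sph_eq (W : Submodule ℝ E) (e : E) : Sph W = Hem W e ∪ Hem W (-e) := by
  ext x
  simp only [Sph, Hem, mem_union, mem_ofPred_eq, inner_neg_right]
  constructor
  · intro h
    rcases le_total 0 ⟪x, e⟫ with h1 | h1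
    · exact Or.inl ⟨h, h1⟩
    · exact Or.inr ⟨h, by linarith⟩
  · rintro (h | h) <;> exact h.1

lemma hem_inter (W : Submodule ℝ E) (e : E) : Hem W e ∩ Hem W (-e) = Sph (W ⊓ (ℝ ∙ e)ᗮ) := by
  ext x
  simp only [Sph, Hem, mem_inter_iff, mem_ofPred_eq, inner_neg_right, Submodule.mem_inf,
    Submodule.mem_orthogonal_singleton_iff_inner_left]
  constructor
  · rintro ⟨⟨h1, h2⟩, -, h3⟩
    exact ⟨h1.1, h1.2, by linarith⟩
  · rintro ⟨h1, h2, h3⟩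
    exact ⟨⟨⟨h1, h2⟩, h3.ge⟩, ⟨h1, h2⟩, by linarith⟩

lemma sph_conn (W : Submodule ℝ E) {e e' : E} (he : ‖e‖ = 1) (heW : e ∈ W) (he' : ‖e'‖ = 1)
    (heW' : e' ∈ W) (h : ⟪e', e⟫ = 0) : IsPreconnected (Sph W) := by
  rw [sph_eq W e]
  refine IsPreconnected.union e' ⟨⟨he', heW'⟩, h.ge⟩ ⟨⟨he', heW'⟩, by simp [h]⟩
    (hem_contr W he heW).preconn (hem_contr W (by simpa using he) (W.neg_mem heW)).preconn

lemma sph_t1 (W : Submodule ℝ E) {e : E} (he : ‖e‖ = 1) (heW : e ∈ W)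
    (h : IsPreconnected (Sph (W ⊓ (ℝ ∙ e)ᗮ))) : T1 (Sph W) := by
  rw [sph_eq W e]
  rw [← hem_inter] at h
  exact glue_t1 (hem_closed _ _) (hem_closed _ _) (hem_contr W he heW).t1
    (hem_contr W (by simpa using he) (W.neg_mem heW)).t1 h

lemma sph_t2 (W : Submodule ℝ E) {e : E} (he : ‖e‖ = 1) (heW : e ∈ W)
    (h : T1 (Sph (W ⊓ (ℝ ∙ e)ᗮ))) : T2 (Sph W) := by
  rw [sph_eq W e]
  rw [← hem_inter] at h
  exact glue_t2 (hem_closed _ _) (hem_closed _ _) (hem_contr W he heW).t2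
    (hem_contr W (by simpa using he) (W.neg_mem heW)).t2 h

end sphere

lemma qj_sq : qj * qj = -1 := by ext <;> simp
lemma qk_sq : qk * qk = -1 := by ext <;> simp

/-- The unit three-sphere. -/
def S3 : Set ℍ[ℝ] := Sph (⊤ : Submodule ℝ ℍ[ℝ])

lemma mem_S3 {x : ℍ[ℝ]} : x ∈ S3 ↔ ‖x‖ = 1 := by simp [S3, Sph]

lemma s3_t2 : T2 S3 := by
  refine sph_t2 _ (e := 1) (by simp) trivial ?_
  refine sph_t1 _ (e := qi) qi_norm ?_ ?_
  · simp [Submodule.mem_orthogonal_singleton_iff_inner_left, Quaternion.inner_def]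
  · refine sph_conn _ (e := qj) (e' := qk) (norm_of_sq qj_sq) ?_ (norm_of_sq qk_sq) ?_ ?_ <;>
    simp [Submodule.mem_orthogonal_singleton_iff_inner_left, Quaternion.inner_def]

lemma s3_conn : IsPreconnected S3 := by
  refine sph_conn _ (e := qj) (e' := qk) (norm_of_sq qj_sq) trivial (norm_of_sq qk_sq) trivial ?_
  simp [Quaternion.inner_def]

lemma s3_t1 : T1 S3 := by
  refine sph_t1 _ (e := 1) (by simp) trivial ?_
  refine sph_conn _ (e := qj) (e' := qk) (norm_of_sq qj_sq) ?_ (norm_of_sq qk_sq) ?_ ?_ <;>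
    simp [Submodule.mem_orthogonal_singleton_iff_inner_left, Quaternion.inner_def]

/-- The square root of `k`. -/
noncomputable def qa : ℍ[ℝ] := ⟨√2 / 2, 0, 0, √2 / 2⟩
@[simp] lemma qa_re : qa.re = √2 / 2 := rfl
@[simp] lemma qa_imI : qa.imI = 0 := rfl
@[simp] lemma qa_imJ : qa.imJ = 0 := rfl
@[simp] lemma qa_imK : qa.imK = √2 / 2 := rfl

lemma half_sq : √2 / 2 * (√2 / 2) = 1 / 2 := by
  have := Real.mul_self_sqrt (show (0 : ℝ) ≤ 2 by norm_num)
  linarith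

lemma qa_sq : qa * qa = qk := by
  ext <;> simp [half_sq]; norm_num

lemma qa_four : qa * qa * qa * qa = -1 := by
  rw [mul_assoc (qa * qa), qa_sq, qk_sq]

lemma qa_eight : qa ^ 8 = 1 := by
  have : qa ^ 8 = (qa * qa * qa * qa) * (qa * qa * qa * qa) := by noncomm_ring
  rw [this, qa_four]; simp

lemma qa_norm : ‖qa‖ = 1 := by
  have : ‖qa‖ * ‖qa‖ = 1 := by rw [← norm_mul, qa_sq, norm_of_sq qk_sq]
  nlinarith [norm_nonneg qa]

lemma aia : qa * qi * qa = qi := by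
  ext <;> simp [half_sq]; norm_num

lemma qi_mul_qa : qi * qa = qa ^ 7 * qi := by
  have h : qa ^ 7 * (qa * qi * qa) = qi * qa := by
    rw [← mul_assoc, ← mul_assoc, ← pow_succ, qa_eight, one_mul]
  rw [← h, aia]

lemma qj_mul (c : ℂ) : qj * (c : ℍ[ℝ]) = ((starRingEnd ℂ c : ℂ) : ℍ[ℝ]) * qj := by
  ext <;> simp

lemma jcjd (c d : ℂ) (x : ℍ[ℝ]) : x * qj * (c : ℍ[ℝ]) * qj * (d : ℍ[ℝ]) =
    x * ((-(starRingEnd ℂ c * d) : ℂ) : ℍ[ℝ]) := by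
  have : qj * (c : ℍ[ℝ]) * qj * (d : ℍ[ℝ]) = ((-(starRingEnd ℂ c * d) : ℂ) : ℍ[ℝ]) := by
    rw [qj_mul, mul_assoc _ qj qj, qj_sq]
    ext <;> simp
  rw [← this]; simp only [mul_assoc]

lemma coe_cancel {x : ℍ[ℝ]} (hx : ‖x‖ = 1) {c d : ℂ} (h : x * (c : ℍ[ℝ]) = x * (d : ℍ[ℝ])) :
    c = d := by
  have hx0 : x ≠ 0 := by rw [← norm_ne_zero_iff, hx]; norm_num
  have h1 := mul_left_cancel₀ hx0 h
  have h2 := congrArg QuaternionAlgebra.re h1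
  have h3 := congrArg QuaternionAlgebra.imI h1
  exact Complex.ext (by simpa using h2) (by simpa using h3)

lemma conj_exp (t : ℝ) : starRingEnd ℂ (Complex.exp (t * Complex.I)) =
    Complex.exp (-(t * Complex.I)) := by
  rw [← Complex.exp_conj]; simp

lemma no_odd (g : ℍ[ℝ] → ℍ[ℝ]) (hg : ContinuousOn g S3) (hg1 : ∀ x ∈ S3, g x * g x = -1)
    (hga : ∀ x ∈ S3, g (x * qa) = - g x) (hgi : ∀ x ∈ S3, g (x * qi) = g x) : False := by
  obtain ⟨ψ, hψ, hψ'⟩ := s3_t2 g hg hg1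
  have ma : ∀ x ∈ S3, x * qa ∈ S3 := fun x hx => by
    rw [mem_S3] at *; rw [norm_mul, hx, qa_norm, one_mul]
  have mi : ∀ x ∈ S3, x * qi ∈ S3 := fun x hx => by
    rw [mem_S3] at *; rw [norm_mul, hx, qi_norm, one_mul]
  have ca : ∀ {F : Type} [TopologicalSpace F] {f : ℍ[ℝ] → F}, ContinuousOn f S3 →
      ContinuousOn (fun x => f (x * qa)) S3 := fun hf =>
    hf.comp (by fun_prop : Continuous fun x : ℍ[ℝ] => x * qa).continuousOn ma
  have ci : ∀ {F : Type} [TopologicalSpace F] {f : ℍ[ℝ] → F}, ContinuousOn f S3 →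
      ContinuousOn (fun x => f (x * qi)) S3 := fun hf =>
    hf.comp (by fun_prop : Continuous fun x : ℍ[ℝ] => x * qi).continuousOn mi
  have fa := fun x (hx : x ∈ S3) => fiber (n := - g x) (p := ψ x * qj) (q := ψ (x * qa))
    (by rw [norm_mul, (hψ' x hx).1, norm_of_sq qj_sq, one_mul]) (hψ' _ (ma x hx)).1
    (by
      have h1 : qi * qj = - (qj * qi) := by ext <;> simp
      rw [neg_mul, ← mul_assoc, (hψ' x hx).2, mul_assoc, h1, mul_neg, neg_neg, mul_assoc])
    (by rw [← hga x hx]; exact (hψ' _ (ma x hx)).2)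
  have fi := fun x (hx : x ∈ S3) => fiber (n := g x) (p := ψ x) (q := ψ (x * qi))
    (hψ' x hx).1 (hψ' _ (mi x hx)).1 (hψ' x hx).2
    (by rw [← hgi x hx]; exact (hψ' _ (mi x hx)).2)
  obtain ⟨θ, hθ, hθ'⟩ := s3_t1 _ (fiber_cont (p := fun x => ψ x * qj)
    (q := fun x => ψ (x * qa)) (hψ.mul continuousOn_const) (ca hψ))
    (fun x hx => by obtain ⟨c, hc, -, rfl⟩ := fa x hx; exact hc)
  obtain ⟨φ, hφ, hφ'⟩ := s3_t1 _ (fiber_cont (p := ψ)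
    (q := fun x => ψ (x * qi)) hψ (ci hψ))
    (fun x hx => by obtain ⟨c, hc, -, rfl⟩ := fi x hx; exact hc)
  have ea : ∀ x ∈ S3, ψ (x * qa) = ψ x * qj * ((Complex.exp (θ x * Complex.I) : ℂ) : ℍ[ℝ]) := by
    intro x hx
    obtain ⟨c, hc, h1, h2⟩ := fa x hx
    rw [hθ' x hx, ← h2]; exact h1
  have ei : ∀ x ∈ S3, ψ (x * qi) = ψ x * ((Complex.exp (φ x * Complex.I) : ℂ) : ℍ[ℝ]) := by
    intro x hx
    obtain ⟨c, hc, h1, h2⟩ := fi x hx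
    rw [hφ' x hx, ← h2]; exact h1
  clear fa fi hθ' hφ'
  obtain ⟨m, hm⟩ := int_const s3_conn (fun x => φ x + φ (x * qi) + θ x - θ (x * qa)
      + θ (x * qa * qa) - θ (x * qa * qa * qa))
      (((((hφ.add (ci hφ)).add hθ).sub (ca hθ)).add (ca (ca hθ))).sub (ca (ca (ca hθ)))) (by
    intro x hx
    have h1 : ψ (x * qi * qi) = ψ (x * qa * qa * qa * qa) := by
      congr 1
      have : x * qa * qa * qa * qa = x * (qa * qa * qa * qa) := by simp only [mul_assoc]
      rw [this, qa_four, mul_assoc, qi_sq]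
    rw [ei _ (mi x hx), ei x hx, ea _ (ma _ (ma _ (ma _ hx))), ea _ (ma _ (ma _ hx)),
      ea _ (ma _ hx), ea _ hx, jcjd, jcjd, mul_assoc, mul_assoc, ← Quaternion.coeComplex_mul,
      ← Quaternion.coeComplex_mul] at h1
    have h2 := coe_cancel (hψ' x hx).1 h1
    rw [neg_mul_neg, conj_exp, conj_exp, ← Complex.exp_add, ← Complex.exp_add, ← Complex.exp_add,
      ← Complex.exp_add] at h2
    have h3 := div_eq_one_iff_eq (Complex.exp_ne_zero _) |>.2 h2
    rw [← Complex.exp_sub] at h3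
    rw [← h3]
    congr 1; push_cast; ring)
  -- second relation
  obtain ⟨n, hn⟩ := int_const s3_conn (fun x => φ x + θ x + φ (x * qa) - θ (x * qa * qi) - Real.pi)
      ((((hφ.add hθ).add (ca hφ)).sub (ca (f := fun x => θ (x * qi)) (ci hθ))).sub
        continuousOn_const) (by
    intro x hx
    have h1 : ψ (x * qi) = ψ (x * qa * qi * qa) := by
      congr 1
      have : x * qa * qi * qa = x * (qa * qi * qa) := by simp only [mul_assoc]
      rw [this, aia]
    rw [ea _ (mi _ (ma _ hx)), ei _ (ma _ hx), ea _ hx, ei _ hx, mul_assoc (ψ x * qj),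
      ← Quaternion.coeComplex_mul, jcjd] at h1
    have h2 := coe_cancel (hψ' x hx).1 h1
    rw [map_mul, conj_exp, conj_exp, ← Complex.exp_add, ← Complex.exp_add] at h2
    have hpi : ∀ z : ℂ, -Complex.exp z = Complex.exp (z + Real.pi * Complex.I) := by
      intro z; rw [Complex.exp_add, Complex.exp_pi_mul_I]; ring
    rw [hpi] at h2
    have h3 := div_eq_one_iff_eq (Complex.exp_ne_zero _) |>.2 h2
    rw [← Complex.exp_sub] at h3
    rw [← h3]
    congr 1; push_cast; ring)
  -- averaging over the orbit of `1`
  let p : ZMod 8 → ℍ[ℝ] := fun r => qa ^ r.val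
  have hp : ∀ r, p r ∈ S3 := fun r => by
    rw [mem_S3]; simp only [p]; rw [norm_pow, qa_norm, one_pow]
  have padd : ∀ r s : ZMod 8, p r * qa ^ s.val = p (r + s) := by
    intro r s
    simp only [p]
    rw [← pow_add, ZMod.val_add, ← pow_eq_pow_mod _ qa_eight]
  have pa : ∀ r, p r * qa = p (r + 1) := fun r => by rw [← padd r 1]; simp [ZMod.val_one'']
  have pia : ∀ r, p r * qi * qa = p (r + 7) * qi := fun r => by
    rw [← padd r 7, mul_assoc, qi_mul_qa, ← mul_assoc]; rfl
  have pii : ∀ r, p r * qi * qi = p (r + 4) := fun r => by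
    have h4 : ZMod.val (4 : ZMod 8) = 4 := rfl
    have h5 : qa ^ 4 = -1 := by rw [← qa_four]; noncomm_ring
    rw [← padd r 4, mul_assoc, qi_sq, h4, h5]
  have shift : ∀ (F : ZMod 8 → ℝ) (s : ZMod 8), ∑ r, F (r + s) = ∑ r, F r := fun F s =>
    Equiv.sum_comp (Equiv.addRight s) F
  let S : (ℍ[ℝ] → ℝ) → ℝ := fun F => ∑ r, F (p r) + ∑ r, F (p r * qi)
  have Sa : ∀ F, S (fun x => F (x * qa)) = S F := by
    intro F
    simp only [S, pa, pia]
    rw [shift (fun r => F (p r)), shift (fun r => F (p r * qi))]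
  have Si : ∀ F, S (fun x => F (x * qi)) = S F := by
    intro F
    simp only [S, pii]
    rw [shift (fun r => F (p r)), add_comm]
  have Sadd : ∀ F G, S (fun x => F x + G x) = S F + S G := by
    intro F G; simp only [S, Finset.sum_add_distrib]; ring
  have Ssub : ∀ F G, S (fun x => F x - G x) = S F - S G := by
    intro F G; simp only [S, Finset.sum_sub_distrib]; ring
  have Sc : ∀ (F : ℍ[ℝ] → ℝ) (c : ℝ), (∀ x ∈ S3, F x = c) → S F = 16 * c := by
    intro F c h
    simp only [S]
    rw [Finset.sum_congr rfl (fun r _ => h _ (hp r)),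
      Finset.sum_congr rfl (fun r _ => h _ (mi _ (hp r)))]
    simp [ZMod.card]; ring
  clear_value S
  have E1 := Sc _ _ hm
  have E2 := Sc _ _ hn
  rw [Ssub, Sadd, Ssub, Sadd, Sadd, Si, Sa (fun x => θ (x * qa * qa)), Sa (fun x => θ (x * qa)),
    Sa] at E1
  rw [Ssub, Ssub, Sadd, Sadd, Sa (fun x => θ (x * qi)), Si, Sa,
    Sc (fun _ => Real.pi) Real.pi (fun _ _ => rfl)] at E2
  have E3 : Real.pi * (2 * m) = Real.pi * (2 * n + 1) := by linarith
  have E4 := mul_left_cancel₀ Real.pi_ne_zero E3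
  have E5 : (2 * m : ℤ) = 2 * n + 1 := by exact_mod_cast E4
  omega

/-- Imaginary part as a Euclidean vector. -/
noncomputable def toE (x : ℍ[ℝ]) : EuclideanSpace ℝ (Fin 3) := !₂[x.imI, x.imJ, x.imK]
/-- Euclidean vectors as imaginary quaternions. -/
def fromE (v : EuclideanSpace ℝ (Fin 3)) : ℍ[ℝ] := ⟨0, v 0, v 1, v 2⟩

lemma toE_cont : Continuous toE := by
  unfold toE
  refine (PiLp.continuous_toLp 2 _).comp (continuous_pi fun i => ?_)
  fin_cases i
  · exact Quaternion.continuous_imI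
  · exact Quaternion.continuous_imJ
  · exact Quaternion.continuous_imK

lemma fromE_cont : Continuous fromE := by
  have : Continuous (fun v : EuclideanSpace ℝ (Fin 3) => v 0 • qi + v 1 • qj + v 2 • qk) := by
    fun_prop
  convert this using 1
  ext v <;> simp [fromE]

lemma fromE_inj {v w : EuclideanSpace ℝ (Fin 3)} (h : fromE v = fromE w) : v = w := by
  have h1 := congrArg QuaternionAlgebra.imI h
  have h2 := congrArg QuaternionAlgebra.imJ h
  have h3 := congrArg QuaternionAlgebra.imK h
  ext i
  fin_cases i
  · exact h1
  · exact h2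
  · exact h3

lemma imag_conj (q n : ℍ[ℝ]) (hn : n.re = 0) : (q * n * star q).re = 0 := by
  simp [hn]; ring

lemma toE_ne {x : ℍ[ℝ]} (h : x.re = 0) (hx : x ≠ 0) : toE x ≠ 0 := by
  intro h0
  apply hx
  have h1 := congrArg (fun v : EuclideanSpace ℝ (Fin 3) => v 0) h0
  have h2 := congrArg (fun v : EuclideanSpace ℝ (Fin 3) => v 1) h0
  have h3 := congrArg (fun v : EuclideanSpace ℝ (Fin 3) => v 2) h0
  ext
  · exact h
  · exact h1
  · exact h2
  · exact h3

lemma imag_sq {x : ℍ[ℝ]} (h : x.re = 0) (hx : ‖x‖ = 1) : x * x = -1 := by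
  have h1 : star x = -x := by ext <;> simp [h]
  have h2 := Quaternion.self_mul_star x
  rw [Quaternion.normSq_eq_norm_mul_self, hx, h1] at h2
  have h3 : -(x * x) = 1 := by simpa using h2
  rw [← h3, neg_neg]

end RP2

open scoped Quaternion in
open RP2 in
/-- **The real projective plane does not embed in `ℝ³`.**
There is no continuous injective map from `ℝP²` (the space of lines through the origin in `ℝ³`,
with the quotient topology from `ℝ³ \ {0}`) to `ℝ³`; since `ℝP²` is compact, this is equivalent
to the nonexistence of a topological embedding. -/
theorem projective_plane_no_continuous_injection_into_R3 :
    ¬ ∃ f : ℙ ℝ (EuclideanSpace ℝ (Fin 3)) → EuclideanSpace ℝ (Fin 3),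
        Continuous f ∧ Function.Injective f := by
  classical
  rintro ⟨f, hf, hinj⟩
  let F : ℍ[ℝ] → ℍ[ℝ] := fun x =>
    if h : toE x ≠ 0 then fromE (f (Projectivization.mk ℝ (toE x) h)) else 0
  have hF : ContinuousOn F {x | toE x ≠ 0} := by
    rw [continuousOn_iff_continuous_domRestrict]
    have h1 : Continuous (fun v : {v : EuclideanSpace ℝ (Fin 3) // v ≠ 0} =>
        Projectivization.mk ℝ v.1 v.2) := continuous_quotient_mk'
    have h2 : Continuous (fun x : {x | toE x ≠ 0} =>
        (⟨toE x, x.2⟩ : {v : EuclideanSpace ℝ (Fin 3) // v ≠ 0})) :=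
      (toE_cont.comp continuous_subtype_val).subtype_mk _
    convert fromE_cont.comp (hf.comp (h1.comp h2)) using 1
    ext1 x
    have hx : toE x ≠ 0 := x.2
    simp [F, hx]
  have hFre : ∀ x, (F x).re = 0 := by
    intro x
    simp only [F]
    split_ifs <;> rfl
  have hFneg : ∀ x, F (-x) = F x := by
    intro x
    have h1 : toE (-x) = - toE x := by
      ext i; fin_cases i <;> simp [toE]
    by_cases hx : toE x ≠ 0
    · have hx' : toE (-x) ≠ 0 := by rw [h1]; simpa using hx
      simp only [F, dif_pos hx, dif_pos hx']
      congr 2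
      rw [Projectivization.mk_eq_mk_iff']
      exact ⟨-1, by rw [h1]; simp⟩
    · have hx' : ¬ toE (-x) ≠ 0 := by rw [h1]; simpa using hx
      simp only [F, dif_neg hx, dif_neg hx']
  have hne : ∀ (n : ℍ[ℝ]), n * n = -1 → ∀ q ∈ S3, toE (q * n * star q) ≠ 0 := by
    intro n hn q hq
    refine toE_ne (imag_conj _ _ (imag_of_sq hn)) ?_
    rw [mem_S3] at hq
    rw [← norm_ne_zero_iff, norm_mul, norm_mul, norm_star, hq, norm_of_sq hn]; norm_num
  let G : ℍ[ℝ] → ℍ[ℝ] := fun q => F (q * qi * star q) - F (q * qj * star q)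
  have hG : ContinuousOn G S3 := by
    refine ContinuousOn.sub ?_ ?_
    · exact hF.comp (by fun_prop : Continuous fun q : ℍ[ℝ] => q * qi * star q).continuousOn
        (hne qi qi_sq)
    · exact hF.comp (by fun_prop : Continuous fun q : ℍ[ℝ] => q * qj * star q).continuousOn
        (hne qj qj_sq)
  have hG0 : ∀ q ∈ S3, G q ≠ 0 := by
    intro q hq h0
    have h1 := sub_eq_zero.1 h0
    simp only [F, dif_pos (hne qi qi_sq q hq), dif_pos (hne qj qj_sq q hq)] at h1
    have h2 := hinj (fromE_inj h1)
    rw [Projectivization.mk_eq_mk_iff'] at h2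
    obtain ⟨c, hc⟩ := h2
    have h3 : q * qi * star q - c • (q * qj * star q) = 0 := by
      by_contra h4
      refine toE_ne ?_ h4 ?_
      · have e1 := imag_conj q qi rfl
        have e2 := imag_conj q qj rfl
        rw [Quaternion.re_sub, Quaternion.re_smul, e1, e2]; simp
      · rw [← sub_eq_zero] at hc
        have : toE (q * qi * star q - c • (q * qj * star q)) =
          -(c • toE (q * qj * star q) - toE (q * qi * star q)) := by
          generalize q * qi * star q = X
          generalize q * qj * star q = Y
          ext i; fin_cases i <;> simp [toE]
        rw [this, hc, neg_zero]
    have hq0 : q ≠ 0 := by rw [mem_S3] at hq; rw [← norm_ne_zero_iff, hq]; norm_num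
    have h5 : q * (qi - c • qj) * star q = 0 := by
      rw [← h3, mul_sub, sub_mul, mul_smul_comm, smul_mul_assoc]
    have h6 : qi - c • qj = 0 := by
      rcases mul_eq_zero.1 h5 with h | h
      · exact (mul_eq_zero.1 h).resolve_left hq0
      · exact absurd (star_eq_zero.1 h) hq0
    have h7 := congrArg QuaternionAlgebra.imI h6
    simp at h7
  have conj_mul : ∀ q a n : ℍ[ℝ], (q * a) * n * star (q * a) = q * (a * n * star a) * star q := by
    intro q a n; rw [star_mul]; simp only [mul_assoc]
  have hneg : ∀ q n : ℍ[ℝ], q * (-n) * star q = -(q * n * star q) := by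
    intro q n; rw [mul_neg, neg_mul]
  have hGa : ∀ q, G (q * qa) = - G q := by
    intro q
    have e1 : qa * qi * star qa = qj := by ext <;> simp [half_sq]; norm_num
    have e2 : qa * qj * star qa = -qi := by ext <;> simp [half_sq]; norm_num
    simp only [G]
    rw [conj_mul, conj_mul, e1, e2, hneg, hFneg, neg_sub]
  have hGi : ∀ q, G (q * qi) = G q := by
    intro q
    have e1 : qi * qi * star qi = qi := by ext <;> simp
    have e2 : qi * qj * star qi = -qj := by ext <;> simp
    simp only [G]
    rw [conj_mul, conj_mul, e1, e2, hneg, hFneg]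
  refine no_odd (fun q => ‖G q‖⁻¹ • G q) ?_ ?_ ?_ ?_
  · exact (hG.norm.inv₀ fun q hq => norm_ne_zero_iff.2 (hG0 q hq)).smul hG
  · intro q hq
    refine imag_sq ?_ ?_
    · rw [Quaternion.re_smul]
      simp [G, hFre]
    · rw [norm_smul, norm_inv, norm_norm, inv_mul_cancel₀ (norm_ne_zero_iff.2 (hG0 q hq))]
  · intro q hq
    simp only [hGa, norm_neg, smul_neg]
  · intro q hq
    simp only [hGi]
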